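/- The product of the G_{H2}-orbits of (1,0) and (0,1), i.e. the 25-element multiset of sums p + q where p ranges over the 5-point orbit G_{H2}((1,0)) and q ranges over the 5-point orbit G_{H2}((0,1)), is equal to the multiset consisting of the ten points of the orbit G_{H2}((1,1)) each with multiplicity one, the ten points of the orbit G_{H2}((τ−1,τ−1)) each with multiplicity one, and the point (0,0) with multiplicity five. -/

import Mathlib

noncomputable section

/-- The golden ratio `τ = (1+√5)/2`, satisfying `τ² = τ + 1`. -/
def τ : ℝ := (1 + Real.sqrt 5) / 2

/-- The first simple reflection in the ω-basis. -/
def f1 : (ℝ × ℝ) →ₗ[ℝ] (ℝ × ℝ) where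
  toFun p := (-p.1, τ * p.1 + p.2)
  map_add' p q := by apply Prod.ext <;> simp <;> ring
  map_smul' c p := by apply Prod.ext <;> simp <;> ring

/-- The second simple reflection in the ω-basis. -/
def f2 : (ℝ × ℝ) →ₗ[ℝ] (ℝ × ℝ) where
  toFun p := (p.1 + τ * p.2, -p.2)
  map_add' p q := by apply Prod.ext <;> simp <;> ring
  map_smul' c p := by apply Prod.ext <;> simp <;> ring

def r1 : (ℝ × ℝ) ≃ₗ[ℝ] (ℝ × ℝ) :=
  LinearEquiv.ofLinear f1 f1
    (by apply LinearMap.ext; intro p; apply Prod.ext <;> simp [f1] <;> ring)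
    (by apply LinearMap.ext; intro p; apply Prod.ext <;> simp [f1] <;> ring)

def r2 : (ℝ × ℝ) ≃ₗ[ℝ] (ℝ × ℝ) :=
  LinearEquiv.ofLinear f2 f2
    (by apply LinearMap.ext; intro p; apply Prod.ext <;> simp [f2] <;> ring)
    (by apply LinearMap.ext; intro p; apply Prod.ext <;> simp [f2] <;> ring)

/-- The Coxeter group, as the group of linear automorphisms of `ℝ²`
generated by the two simple reflections. -/
def GH2 : Subgroup ((ℝ × ℝ) ≃ₗ[ℝ] (ℝ × ℝ)) := Subgroup.closure {r1, r2}

/-- The orbit of `(1,0)` as a finite set. -/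
def O10 : Finset (ℝ × ℝ) := {(1, 0), (-1, τ), (τ, -τ), (-τ, 1), (0, -1)}

/-- The orbit of `(0,1)` as a finite set. -/
def O01 : Finset (ℝ × ℝ) := {(0, 1), (τ, -1), (-τ, τ), (1, -τ), (-1, 0)}

/-- The orbit of `(1,1)` as a finite set. -/
def O11 : Finset (ℝ × ℝ) :=
  {(1, 1), (-1, 1 + τ), (2 * τ, -1 - τ), (-2 * τ, 1 + τ), (1, -1 - τ),
   (1 + τ, -1), (-1 - τ, 2 * τ), (1 + τ, -2 * τ), (-1 - τ, 1), (-1, -1)}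

/-- The orbit of `(τ−1,τ−1)` as a finite set. -/
def Ot : Finset (ℝ × ℝ) :=
  {(τ - 1, τ - 1), (1 - τ, τ), (2, -τ), (-2, τ), (τ - 1, -τ),
   (τ, 1 - τ), (-τ, 2), (τ, -2), (-τ, τ - 1), (1 - τ, 1 - τ)}

theorem tau_sq : τ * τ = τ + 1 := by
  have h : Real.sqrt 5 * Real.sqrt 5 = 5 := Real.mul_self_sqrt (by norm_num)
  unfold τ
  linarith

theorem one_lt_tau : 1 < τ := by
  have h : (1 : ℝ) < Real.sqrt 5 := Real.lt_sqrt_of_sq_lt (by norm_num)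
  unfold τ
  linarith

theorem tau_lt_two : τ < 2 := by
  nlinarith [tau_sq, one_lt_tau]

theorem r1_apply (p : ℝ × ℝ) : r1 p = (-p.1, τ * p.1 + p.2) := rfl

theorem r2_apply (p : ℝ × ℝ) : r2 p = (p.1 + τ * p.2, -p.2) := rfl

theorem r1_r1 (p : ℝ × ℝ) : r1 (r1 p) = p := r1.left_inv p

theorem r2_r2 (p : ℝ × ℝ) : r2 (r2 p) = p := r2.left_inv p

theorem r1_mem_orbit {v p : ℝ × ℝ} (h : p ∈ MulAction.orbit GH2 v) :
    r1 p ∈ MulAction.orbit GH2 v :=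
  MulAction.mem_orbit_of_mem_orbit
    (⟨r1, Subgroup.subset_closure (Set.mem_insert _ _)⟩ : GH2) h

theorem r2_mem_orbit {v p : ℝ × ℝ} (h : p ∈ MulAction.orbit GH2 v) :
    r2 p ∈ MulAction.orbit GH2 v :=
  MulAction.mem_orbit_of_mem_orbit
    (⟨r2, Subgroup.subset_closure (Set.mem_insert_of_mem _ rfl)⟩ : GH2) h

/-- A set stable under both simple reflections contains the orbit of each of its points. -/
theorem orbit_subset {S : Set (ℝ × ℝ)} {v : ℝ × ℝ} (hv : v ∈ S)
    (h1 : ∀ p ∈ S, r1 p ∈ S) (h2 : ∀ p ∈ S, r2 p ∈ S) :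
    MulAction.orbit GH2 v ⊆ S := by
  have key : ∀ g ∈ GH2, ∀ p, g p ∈ S ↔ p ∈ S := by
    intro g hg
    induction hg using Subgroup.closure_induction with
    | mem g hg =>
      rcases hg with rfl | rfl
      · exact fun p => ⟨fun h => r1_r1 p ▸ h1 _ h, h1 p⟩
      · exact fun p => ⟨fun h => r2_r2 p ▸ h2 _ h, h2 p⟩
    | one => exact fun p => Iff.rfl
    | mul a b _ _ ha hb => exact fun p => (ha (b p)).trans (hb p)
    | inv a _ ha =>
      intro p
      rw [← ha (a⁻¹ p)]
      exact iff_of_eq (congrArg (· ∈ S) (a.apply_symm_apply p))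
  rintro _ ⟨⟨g, hg⟩, rfl⟩
  exact (key g hg v).2 hv

/-- The ten (not necessarily distinct) points of the orbit of a general point. -/
theorem orbit_mk (a b : ℝ) :
    MulAction.orbit GH2 ((a, b) : ℝ × ℝ) =
      {(a, b), (-a, τ * a + b), (τ * a + τ * b, -(τ * a) - b),
        (-(τ * a) - τ * b, a + τ * b), (b, -a - τ * b), (-b, -a),
        (a + τ * b, -b), (-a - τ * b, τ * a + τ * b),
        (τ * a + b, -(τ * a) - τ * b), (-(τ * a) - b, a)} := by
  have ht := tau_sq
  apply Set.Subset.antisymm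
  · apply orbit_subset
    · simp
    all_goals
      intro p hp
      simp only [Set.mem_insert_iff, Set.mem_singleton_iff, r1_apply, r2_apply] at hp ⊢
      rcases hp with rfl | rfl | rfl | rfl | rfl | rfl | rfl | rfl | rfl | rfl <;> grind
  · have move1 : ∀ {p : ℝ × ℝ} (q : ℝ × ℝ), p ∈ MulAction.orbit GH2 (a, b) → r1 p = q →
        q ∈ MulAction.orbit GH2 (a, b) := fun _ h e => e ▸ r1_mem_orbit h
    have move2 : ∀ {p : ℝ × ℝ} (q : ℝ × ℝ), p ∈ MulAction.orbit GH2 (a, b) → r2 p = q →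
        q ∈ MulAction.orbit GH2 (a, b) := fun _ h e => e ▸ r2_mem_orbit h
    have hv := MulAction.mem_orbit_self (M := GH2) ((a, b) : ℝ × ℝ)
    have h1 := move1 (-a, τ * a + b) hv rfl
    have h21 := move2 (τ * a + τ * b, -(τ * a) - b) h1 (by simp only [r2_apply]; grind)
    have h121 := move1 (-(τ * a) - τ * b, a + τ * b) h21 (by simp only [r1_apply]; grind)
    have h2121 := move2 (b, -a - τ * b) h121 (by simp only [r2_apply]; grind)
    have h12121 := move1 (-b, -a) h2121 (by simp only [r1_apply]; grind)
    have h2 := move2 (a + τ * b, -b) hv rfl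
    have h12 := move1 (-a - τ * b, τ * a + τ * b) h2 (by simp only [r1_apply]; grind)
    have h212 := move2 (τ * a + b, -(τ * a) - τ * b) h12 (by simp only [r2_apply]; grind)
    have h1212 := move1 (-(τ * a) - b, a) h212 (by simp only [r1_apply]; grind)
    simp only [Set.insert_subset_iff, Set.singleton_subset_iff]
    exact ⟨hv, h1, h21, h121, h2121, h12121, h2, h12, h212, h1212⟩

theorem coe_O10_eq_orbit :
    (↑O10 : Set (ℝ × ℝ)) = MulAction.orbit GH2 ((1, 0) : ℝ × ℝ) := by
  have ht := tau_sq
  rw [orbit_mk]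
  ext p
  simp only [O10, Finset.coe_insert, Finset.coe_singleton, Set.mem_insert_iff,
    Set.mem_singleton_iff]
  grind

theorem coe_O01_eq_orbit :
    (↑O01 : Set (ℝ × ℝ)) = MulAction.orbit GH2 ((0, 1) : ℝ × ℝ) := by
  have ht := tau_sq
  rw [orbit_mk]
  ext p
  simp only [O01, Finset.coe_insert, Finset.coe_singleton, Set.mem_insert_iff,
    Set.mem_singleton_iff]
  grind

theorem coe_O11_eq_orbit :
    (↑O11 : Set (ℝ × ℝ)) = MulAction.orbit GH2 ((1, 1) : ℝ × ℝ) := by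
  have ht := tau_sq
  rw [orbit_mk]
  ext p
  simp only [O11, Finset.coe_insert, Finset.coe_singleton, Set.mem_insert_iff,
    Set.mem_singleton_iff]
  grind

theorem coe_Ot_eq_orbit :
    (↑Ot : Set (ℝ × ℝ)) = MulAction.orbit GH2 ((τ - 1, τ - 1) : ℝ × ℝ) := by
  have ht := tau_sq
  rw [orbit_mk]
  ext p
  simp only [Ot, Finset.coe_insert, Finset.coe_singleton, Set.mem_insert_iff,
    Set.mem_singleton_iff]
  grind

theorem O10_val : O10.val =
    {(1, 0), (-1, τ), (τ, -τ), (-τ, 1), (0, -1)} := by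
  have h1 := one_lt_tau
  have h2 := tau_lt_two
  unfold O10
  repeat rw [Finset.insert_val_of_notMem (by
    simp only [Finset.mem_insert, Finset.mem_singleton, Prod.mk.injEq]; grind)]
  rfl

theorem O01_val : O01.val =
    {(0, 1), (τ, -1), (-τ, τ), (1, -τ), (-1, 0)} := by
  have h1 := one_lt_tau
  have h2 := tau_lt_two
  unfold O01
  repeat rw [Finset.insert_val_of_notMem (by
    simp only [Finset.mem_insert, Finset.mem_singleton, Prod.mk.injEq]; grind)]
  rfl

theorem O11_val : O11.val =
    {(1, 1), (-1, 1 + τ), (2 * τ, -1 - τ), (-2 * τ, 1 + τ), (1, -1 - τ),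
      (1 + τ, -1), (-1 - τ, 2 * τ), (1 + τ, -2 * τ), (-1 - τ, 1), (-1, -1)} := by
  have h1 := one_lt_tau
  have h2 := tau_lt_two
  unfold O11
  repeat rw [Finset.insert_val_of_notMem (by
    simp only [Finset.mem_insert, Finset.mem_singleton, Prod.mk.injEq]; grind)]
  rfl

theorem Ot_val : Ot.val =
    {(τ - 1, τ - 1), (1 - τ, τ), (2, -τ), (-2, τ), (τ - 1, -τ),
      (τ, 1 - τ), (-τ, 2), (τ, -2), (-τ, τ - 1), (1 - τ, 1 - τ)} := by
  have h1 := one_lt_tau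
  have h2 := tau_lt_two
  unfold Ot
  repeat rw [Finset.insert_val_of_notMem (by
    simp only [Finset.mem_insert, Finset.mem_singleton, Prod.mk.injEq]; grind)]
  rfl

theorem product_of_H2_orbits :
    (↑O10 : Set (ℝ × ℝ)) = MulAction.orbit GH2 ((1, 0) : ℝ × ℝ) ∧
    (↑O01 : Set (ℝ × ℝ)) = MulAction.orbit GH2 ((0, 1) : ℝ × ℝ) ∧
    (↑O11 : Set (ℝ × ℝ)) = MulAction.orbit GH2 ((1, 1) : ℝ × ℝ) ∧
    (↑Ot : Set (ℝ × ℝ)) = MulAction.orbit GH2 ((τ - 1, τ - 1) : ℝ × ℝ) ∧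
    (O10.val.bind fun p => O01.val.map fun q => p + q) =
      O11.val + Ot.val + Multiset.replicate 5 ((0, 0) : ℝ × ℝ) := by
  refine ⟨coe_O10_eq_orbit, coe_O01_eq_orbit, coe_O11_eq_orbit, coe_Ot_eq_orbit, ?_⟩
  rw [O10_val, O01_val, O11_val, Ot_val]
  simp only [Multiset.insert_eq_cons, ← Multiset.singleton_add, Multiset.add_bind,
    Multiset.singleton_bind, Multiset.map_add, Multiset.map_singleton, Prod.mk_add_mk,
    Multiset.replicate_succ, Multiset.replicate_zero]
  ring_nf
  abel
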